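/- Let C be a category, R a C-indexed poset, F an endofunctor of C, and F̂ a lifting of F to ∫R. Let δ : d → F d be an F-coalgebra and suppose ν_δ ∈ R(d) is a greatest post-fixpoint of the monotone operator δ* ∘ F̂_d on R(d). Let γ : c → F c be an F-coalgebra, R ∈ R(c) with R ≤ γ*(F̂_c(R)), and f : c → d a coalgebra homomorphism from γ to δ (i.e., δ ∘ f = F f ∘ γ). If the subset {S ∈ R(d) | R ≤ f*(S)} of R(d) is a sub co-ipo of R(d) (it contains the greatest element of R(d) and is closed under meets of codirected subsets, these meets existing in R(d)), then R ≤ f*(ν_δ), i.e., f is a morphism (c, R) → (d, ν_δ) in ∫R. -/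

import Mathlib

open CategoryTheory

universe w v u

/-- A `C`-indexed poset: a contravariant functor from `C` to posets. -/
structure IndexedPoset (C : Type u) [Category.{v} C] where
  obj : C → Type w
  po : ∀ c, PartialOrder (obj c)
  map : ∀ {c d : C}, (c ⟶ d) → obj d → obj c
  map_mono : ∀ {c d : C} (f : c ⟶ d), Monotone (map f)
  map_id : ∀ (c : C) (S : obj c), map (𝟙 c) S = S
  map_comp : ∀ {c d e : C} (f : c ⟶ d) (g : d ⟶ e) (S : obj e),
    map (f ≫ g) S = map f (map g S)

attribute [instance] IndexedPoset.po

variable {C : Type u} [Category.{v} C]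

/-- The Grothendieck category `∫R` of a `C`-indexed poset `R`. -/
structure Groth (R : IndexedPoset C) where
  base : C
  fib : R.obj base

instance Groth.category (R : IndexedPoset C) : Category (Groth R) where
  Hom X Y := { f : X.base ⟶ Y.base // X.fib ≤ R.map f Y.fib }
  id X := ⟨𝟙 X.base, (R.map_id X.base X.fib).ge⟩
  comp {X Y Z} f g := ⟨f.val ≫ g.val, by
    rw [R.map_comp]
    exact le_trans f.property (R.map_mono f.val g.property)⟩
  id_comp f := by apply Subtype.ext; simp
  comp_id f := by apply Subtype.ext; simp
  assoc f g h := by apply Subtype.ext; simp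

/-- The forgetful functor `U : ∫R ⥤ C`. -/
def grothForget (R : IndexedPoset C) : Groth R ⥤ C where
  obj X := X.base
  map f := f.val

theorem Groth.eq_mk {R : IndexedPoset C} (X : Groth R) {b : C} (h : X.base = b) :
    X = ⟨b, cast (congrArg R.obj h) X.fib⟩ := by
  cases X
  cases h
  rfl

/-- Given an endofunctor `F̂` of `∫R` lifting `F : C ⥤ C` (i.e. `U ∘ F̂ = F ∘ U`),
the induced fibre map `F̂_c : R(c) → R(F c)`. -/
def liftObj (R : IndexedPoset C) {F : C ⥤ C} (Fhat : Groth R ⥤ Groth R)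
    (H : Fhat ⋙ grothForget R = grothForget R ⋙ F) {c : C} (Rc : R.obj c) :
    R.obj (F.obj c) :=
  cast (congrArg R.obj (Functor.congr_obj H ⟨c, Rc⟩)) (Fhat.obj ⟨c, Rc⟩).fib

theorem Groth.cast_fib_le {R : IndexedPoset C} {X Y : Groth R} (m : X ⟶ Y) {a b : C}
    (hX : X.base = a) (hY : Y.base = b) (g : a ⟶ b)
    (hm : m.val = eqToHom hX ≫ g ≫ eqToHom hY.symm) :
    cast (congrArg R.obj hX) X.fib ≤ R.map g (cast (congrArg R.obj hY) Y.fib) := by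
  subst hX hY
  obtain rfl : m.val = g := by simpa using hm
  exact m.property

theorem liftObj_le_map {R : IndexedPoset C} {F : C ⥤ C} (Fhat : Groth R ⥤ Groth R)
    (H : Fhat ⋙ grothForget R = grothForget R ⋙ F) {c d : C} (f : c ⟶ d)
    {S : R.obj c} {T : R.obj d} (h : S ≤ R.map f T) :
    liftObj R Fhat H S ≤ R.map (F.map f) (liftObj R Fhat H T) := by
  let m : (⟨c, S⟩ : Groth R) ⟶ ⟨d, T⟩ := ⟨f, h⟩
  exact Groth.cast_fib_le (Fhat.map m) (Functor.congr_obj H ⟨c, S⟩)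
    (Functor.congr_obj H ⟨d, T⟩) (F.map f) (Functor.congr_hom H m)

theorem liftObj_mono {R : IndexedPoset C} {F : C ⥤ C} (Fhat : Groth R ⥤ Groth R)
    (H : Fhat ⋙ grothForget R = grothForget R ⋙ F) {c : C} :
    Monotone (liftObj R Fhat H : R.obj c → R.obj (F.obj c)) := by
  intro S T h
  have := liftObj_le_map Fhat H (𝟙 c) (h.trans (R.map_id c T).ge)
  rwa [F.map_id, R.map_id] at this

/-- A monotone map preserving a subset closed under meets of codirected (possibly empty) subsets
has a fixed point in that subset. -/
theorem Monotone.exists_fixedPoint_mem_of_codirected_isGLB {α : Type*} [PartialOrder α]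
    {φ : α → α} (hφ : Monotone φ) {P : Set α} (hP : Set.MapsTo φ P P)
    (hmeet : ∀ T ⊆ P, DirectedOn (· ≥ ·) T → ∃ g, IsGLB T g ∧ g ∈ P) :
    ∃ x ∈ P, φ x = x := by
  obtain ⟨m, hm⟩ : ∃ m, Minimal (fun x => x ∈ P ∧ φ x ≤ x) m := by
    refine zorn_le₀ (α := αᵒᵈ) {x | x ∈ P ∧ φ x ≤ x} fun T hT hchain => ?_
    obtain ⟨g, hg, hgP⟩ := hmeet T (fun x hx => (hT hx).1) hchain.directedOn
    exact ⟨g, ⟨hgP, hg.2 fun x hx => (hφ (hg.1 hx)).trans (hT hx).2⟩, fun x hx => hg.1 hx⟩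
  exact ⟨m, hm.prop.1, le_antisymm hm.prop.2 (hm.2 ⟨hP hm.prop.1, hφ hm.prop.2⟩ hm.prop.2)⟩

/-- Lemma: let `νδ` be the greatest post-fixpoint of `δ* ∘ F̂_d`, let
`(c, Rc)` lift the coalgebra `γ`, and let `f` be a coalgebra homomorphism from
`γ` to `δ`. If `{S ∈ R(d) | Rc ≤ f*(S)}` is a sub co-ipo of `R(d)` (it
contains the greatest element and is closed under meets of codirected subsets,
these meets existing in `R(d)`), then `Rc ≤ f*(νδ)`. -/
theorem postfixpoint_lifting_subcoipo (R : IndexedPoset C)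
    (F : C ⥤ C) (Fhat : Groth R ⥤ Groth R)
    (H : Fhat ⋙ grothForget R = grothForget R ⋙ F)
    {d : C} (δ : d ⟶ F.obj d) (νδ : R.obj d)
    (hpost : νδ ≤ R.map δ (liftObj R Fhat H νδ))
    (hgreatest : ∀ S : R.obj d, S ≤ R.map δ (liftObj R Fhat H S) → S ≤ νδ)
    {c : C} (γ : c ⟶ F.obj c) (Rc : R.obj c)
    (hRc : Rc ≤ R.map γ (liftObj R Fhat H Rc))
    (f : c ⟶ d) (hf : f ≫ δ = γ ≫ F.map f)
    (htop : ∃ tt : R.obj d, (∀ x : R.obj d, x ≤ tt) ∧ Rc ≤ R.map f tt)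
    (hmeet : ∀ T : Set (R.obj d), T ⊆ {S : R.obj d | Rc ≤ R.map f S} →
      DirectedOn (· ≥ ·) T → ∃ g : R.obj d, IsGLB T g ∧ Rc ≤ R.map f g) :
    Rc ≤ R.map f νδ := by
  have hP : Set.MapsTo (fun S => R.map δ (liftObj R Fhat H S))
      {S | Rc ≤ R.map f S} {S | Rc ≤ R.map f S} := fun S hS => by
    change Rc ≤ R.map f (R.map δ (liftObj R Fhat H S))
    rw [← R.map_comp, hf, R.map_comp]
    exact hRc.trans (R.map_mono γ (liftObj_le_map Fhat H f hS))
  obtain ⟨S, hS, hfix⟩ := ((R.map_mono δ).comp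
    (liftObj_mono Fhat H)).exists_fixedPoint_mem_of_codirected_isGLB hP hmeet
  exact hS.trans (R.map_mono f (hgreatest S hfix.ge))
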